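/- arXiv:2112.00845 — 4 statements merged into one kernel-verified Lean document; each statement's English description precedes it below -/
import Mathlib

section
/- Let d, B ≥ 1, let ∇w ∈ ℝ^d, let Σ be a positive semidefinite d×d covariance matrix, and let σ ≥ 0. Let g_1, …, g_B be i.i.d. samples from the Gaussian N(∇w, Σ) on ℝ^d, and, conditionally on (g_1, …, g_B), let ξ_DP be drawn from N(0, S²σ²I_d) with S² = max_{1≤i≤B} ‖g_i‖². Then the mean square error of the perturbed gradient g̃ = g_1 + ξ_DP satisfies E[‖g̃ − ∇w‖²] ≥ Tr(Σ)·(1 + dσ²). -/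
open MeasureTheory ProbabilityTheory
open scoped ProbabilityTheory

/-- `IsGaussian m S μ` : `μ` is the Gaussian measure `N(m, S)` on `ℝ^d`, characterized
(Cramér–Wold) by the fact that every one-dimensional linear marginal `x ↦ ⟨a, x⟩` is the
real Gaussian with mean `⟨a, m⟩` and variance `aᵀ S a`. -/
def IsGaussian {d : ℕ} (m : EuclideanSpace ℝ (Fin d)) (S : Matrix (Fin d) (Fin d) ℝ)
    (μ : Measure (EuclideanSpace ℝ (Fin d))) : Prop :=
  IsProbabilityMeasure μ ∧
    ∀ a : EuclideanSpace ℝ (Fin d),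
      μ.map (fun x => ∑ i, a i * x i) =
        gaussianReal (∑ i, a i * m i) (Real.toNNReal (∑ i, ∑ j, a i * S i j * a j))

lemma aux_real (m : ℝ) (v : NNReal) (c : ℝ) :
    ∫⁻ x, ENNReal.ofReal ((x + c) ^ 2) ∂(gaussianReal m v) =
      ENNReal.ofReal (v + (m + c) ^ 2) := by
  have hmap : (gaussianReal m v).map (fun x => x + c) = gaussianReal (m + c) v :=
    gaussianReal_map_add_const c
  have h1 : ∫⁻ x, ENNReal.ofReal ((x + c) ^ 2) ∂(gaussianReal m v)
      = ∫⁻ y, ENNReal.ofReal (y ^ 2) ∂(gaussianReal (m + c) v) := by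
    rw [← hmap, lintegral_map (by fun_prop) (by fun_prop)]
  have hL : MemLp id 2 (gaussianReal (m + c) v) := memLp_id_gaussianReal 2
  have hint : Integrable (fun y : ℝ => y ^ 2) (gaussianReal (m + c) v) := hL.integrable_sq
  rw [h1, ← ofReal_integral_eq_lintegral_ofReal hint (ae_of_all _ fun y => sq_nonneg y)]
  congr 1
  have hv : Var[id; gaussianReal (m + c) v] = v := variance_id_gaussianReal
  rw [variance_eq_sub hL] at hv
  have hm : ∫ x, id x ∂(gaussianReal (m + c) v) = m + c := integral_id_gaussianReal
  rw [hm] at hv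
  have : ∫ x, (id ^ 2 : ℝ → ℝ) x ∂(gaussianReal (m + c) v)
    = ∫ x, x ^ 2 ∂(gaussianReal (m + c) v) := rfl
  linarith

lemma aux_vec {d : ℕ} (m : EuclideanSpace ℝ (Fin d)) (S : Matrix (Fin d) (Fin d) ℝ)
    (μ : Measure (EuclideanSpace ℝ (Fin d))) (h : _root_.IsGaussian m S μ)
    (hS : ∀ i, 0 ≤ S i i) (c : EuclideanSpace ℝ (Fin d)) :
    ∫⁻ x, ENNReal.ofReal (‖x + c‖ ^ 2) ∂μ = ENNReal.ofReal (S.trace + ‖m + c‖ ^ 2) := by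
  have hi : ∀ i, ∫⁻ x, ENNReal.ofReal ((x i + c i) ^ 2) ∂μ
      = ENNReal.ofReal (S i i + (m i + c i) ^ 2) := by
    intro i
    have := h.2 (EuclideanSpace.single i 1)
    simp [Pi.single_apply] at this
    have h2 := aux_real (m i) (S i i).toNNReal (c i)
    rw [← this, lintegral_map (by fun_prop) (by fun_prop), Real.coe_toNNReal _ (hS i)] at h2
    exact h2
  simp_rw [EuclideanSpace.real_norm_sq_eq, PiLp.add_apply]
  simp only [Matrix.trace, Matrix.diag_apply]
  rw [← Finset.sum_add_distrib,
    ENNReal.ofReal_sum_of_nonneg (fun i _ => add_nonneg (hS i) (sq_nonneg _))]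
  simp_rw [ENNReal.ofReal_sum_of_nonneg (fun i _ => sq_nonneg _)]
  rw [lintegral_finsetSum _ (fun i _ => by fun_prop)]
  exact Finset.sum_congr rfl fun i _ => hi i

/-- Theorem 1 of the paper: if `g_1, …, g_B` are i.i.d. `N(∇w, Σ)` and,
conditionally on the batch, `ξ_DP ∼ N(0, S² σ² I_d)` with `S² = max_i ‖g_i‖²`, then the
mean square error of the perturbed gradient `g̃ = g_1 + ξ_DP` satisfies
`E[‖g̃ − ∇w‖²] ≥ Tr(Σ)(1 + d σ²)`. The joint law of `(g, ξ_DP)` is the composition-product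
of the i.i.d. law with the conditional Gaussian kernel. -/
theorem mse_lower_bound {d B : ℕ} (hd : 1 ≤ d) (hB : 1 ≤ B)
    (gradw : EuclideanSpace ℝ (Fin d)) (Cov : Matrix (Fin d) (Fin d) ℝ)
    (hCov : Cov.PosSemidef) (σ : ℝ) (hσ : 0 ≤ σ)
    (ν : Measure (EuclideanSpace ℝ (Fin d))) [IsProbabilityMeasure ν]
    (hν : IsGaussian gradw Cov ν)
    (κ : Kernel (Fin B → EuclideanSpace ℝ (Fin d)) (EuclideanSpace ℝ (Fin d)))
    [IsMarkovKernel κ]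
    (hκ : ∀ g : Fin B → EuclideanSpace ℝ (Fin d),
      IsGaussian 0 (((⨆ i, ‖g i‖ ^ 2) * σ ^ 2) • (1 : Matrix (Fin d) (Fin d) ℝ)) (κ g)) :
    ENNReal.ofReal (Cov.trace * (1 + d * σ ^ 2)) ≤
      ∫⁻ p, ENNReal.ofReal (‖(p.1 ⟨0, hB⟩ + p.2) - gradw‖ ^ 2)
        ∂((Measure.pi fun _ : Fin B => ν) ⊗ₘ κ) := by
  have hdiag : ∀ i, 0 ≤ Cov i i := fun i => hCov.diag_nonneg
  have htr : 0 ≤ Cov.trace := Finset.sum_nonneg fun i _ => hdiag i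
  have hk : 0 ≤ d * σ ^ 2 := by positivity
  rw [Measure.lintegral_compProd (by fun_prop)]
  have hinner : ∀ g : Fin B → EuclideanSpace ℝ (Fin d),
      ENNReal.ofReal (d * σ ^ 2) * ENNReal.ofReal (‖g ⟨0, hB⟩ + 0‖ ^ 2)
        + ENNReal.ofReal (‖g ⟨0, hB⟩ + -gradw‖ ^ 2) ≤
      ∫⁻ ξ, ENNReal.ofReal (‖(g ⟨0, hB⟩ + ξ) - gradw‖ ^ 2) ∂(κ g) := by
    intro g
    have hle : ‖g ⟨0, hB⟩‖ ^ 2 ≤ ⨆ i, ‖g i‖ ^ 2 :=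
      le_ciSup (f := fun i => ‖g i‖ ^ 2) (Set.finite_range _).bddAbove ⟨0, hB⟩
    have hs : 0 ≤ ⨆ i, ‖g i‖ ^ 2 := (sq_nonneg _).trans hle
    have := aux_vec _ _ _ (hκ g) (fun i => by simp; positivity) (g ⟨0, hB⟩ + -gradw)
    have e : ∀ ξ, (g ⟨0, hB⟩ + ξ) - gradw = ξ + (g ⟨0, hB⟩ + -gradw) := fun ξ => by abel
    simp_rw [e]
    rw [this, ← ENNReal.ofReal_mul hk, ← ENNReal.ofReal_add (by positivity) (by positivity)]
    apply ENNReal.ofReal_le_ofReal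
    rw [Matrix.trace_smul, Matrix.trace_one, Fintype.card_fin, zero_add, add_zero, smul_eq_mul]
    have := mul_le_mul_of_nonneg_left hle hk
    linarith
  refine le_trans ?_ (lintegral_mono hinner)
  have hmp := measurePreserving_eval (fun _ : Fin B => ν) ⟨0, hB⟩
  have hf : Measurable fun x : EuclideanSpace ℝ (Fin d) =>
      ENNReal.ofReal (d * σ ^ 2) * ENNReal.ofReal (‖x + 0‖ ^ 2)
        + ENNReal.ofReal (‖x + -gradw‖ ^ 2) := by fun_prop
  have := hmp.lintegral_comp hf
  simp only [Function.eval] at this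
  rw [this, lintegral_add_right _ (by fun_prop), lintegral_const_mul _ (by fun_prop),
    aux_vec _ _ _ hν hdiag, aux_vec _ _ _ hν hdiag, ← ENNReal.ofReal_mul hk,
    ← ENNReal.ofReal_add (by positivity) (by positivity)]
  apply ENNReal.ofReal_le_ofReal
  have := mul_nonneg hk (sq_nonneg ‖gradw + 0‖)
  have := sq_nonneg ‖gradw + -gradw‖
  linarith
end

section
/- Let d, B ≥ 1, let ∇w ∈ ℝ^d, let λ ≥ 0 and σ ≥ 0. Let g_1, …, g_B be i.i.d. samples from the Gaussian N(∇w, λI_d) on ℝ^d, and, conditionally on (g_1, …, g_B), let ξ_DP be drawn from N(0, S²σ²I_d) with S² = max_{1≤i≤B} ‖g_i‖². Then E[‖(g_1 + ξ_DP) − ∇w‖²] ≥ λd + λσ²d², i.e. for isotropic gradient covariance the mean square error of the perturbed gradient grows at least quadratically in the dimension d. -/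
open MeasureTheory ProbabilityTheory
open scoped ProbabilityTheory

lemma aux_gauss (m v : ℝ) (c : NNReal) :
    ∫⁻ x, ENNReal.ofReal ((v + x) ^ 2) ∂(gaussianReal m c) = ENNReal.ofReal ((v + m) ^ 2 + c) := by
  have h1 : ∫⁻ x, ENNReal.ofReal ((v + x) ^ 2) ∂(gaussianReal m c)
      = ∫⁻ y, ENNReal.ofReal (y ^ 2) ∂(gaussianReal (m + v) c) := by
    rw [← gaussianReal_map_const_add v, lintegral_map (by fun_prop) (by fun_prop)]
  have hL : MemLp id 2 (gaussianReal (m + v) c) := memLp_id_gaussianReal' 2 (by simp)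
  have hv := variance_eq_sub hL
  rw [variance_id_gaussianReal] at hv
  have hm : ∫ x, id x ∂(gaussianReal (m + v) c) = m + v := by simp
  rw [h1, ← ofReal_integral_eq_lintegral_ofReal (f := fun y : ℝ => y ^ 2) hL.integrable_sq
    (Filter.Eventually.of_forall fun x => sq_nonneg x)]
  congr 1
  rw [hm] at hv
  simp only [Pi.pow_apply, id] at hv
  linarith

lemma aux_norm {d : ℕ} (m v : EuclideanSpace ℝ (Fin d)) (c : ℝ) (hc : 0 ≤ c)
    (μ : Measure (EuclideanSpace ℝ (Fin d)))
    (h : IsGaussian m (c • (1 : Matrix (Fin d) (Fin d) ℝ)) μ) :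
    ∫⁻ x, ENNReal.ofReal (‖v + x‖ ^ 2) ∂μ = ENNReal.ofReal (‖v + m‖ ^ 2 + c * d) := by
  have hi : ∀ i, ∫⁻ x, ENNReal.ofReal ((v i + x i) ^ 2) ∂μ
      = ENNReal.ofReal ((v i + m i) ^ 2 + c) := by
    intro i
    have h2 := h.2 (EuclideanSpace.single i 1)
    have e : μ.map (fun x => x i) = gaussianReal (m i) c.toNNReal := by
      simpa [Matrix.one_apply, Pi.single_apply] using h2
    have := aux_gauss (m i) (v i) c.toNNReal
    rw [← e, lintegral_map (by fun_prop) (by fun_prop), Real.coe_toNNReal c hc] at this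
    exact this
  simp only [EuclideanSpace.real_norm_sq_eq, PiLp.add_apply]
  simp_rw [ENNReal.ofReal_sum_of_nonneg (fun i _ => sq_nonneg _)]
  rw [lintegral_finsetSum _ (fun i _ => by fun_prop)]
  simp_rw [hi]
  rw [← ENNReal.ofReal_sum_of_nonneg (fun i _ => by positivity), Finset.sum_add_distrib]
  simp [mul_comm]

/-- Isotropic specialization of the paper's Theorem 1: if `g_1, …, g_B`
are i.i.d. `N(∇w, λ I_d)` and, conditionally on the batch, `ξ_DP ∼ N(0, S² σ² I_d)` with
`S² = max_i ‖g_i‖²`, then `E[‖(g_1 + ξ_DP) − ∇w‖²] ≥ λ d + λ σ² d²`. -/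
theorem mse_lower_bound_isotropic {d B : ℕ} (hd : 1 ≤ d) (hB : 1 ≤ B)
    (gradw : EuclideanSpace ℝ (Fin d)) (lam : ℝ) (hlam : 0 ≤ lam) (σ : ℝ) (hσ : 0 ≤ σ)
    (ν : Measure (EuclideanSpace ℝ (Fin d))) [IsProbabilityMeasure ν]
    (hν : IsGaussian gradw (lam • (1 : Matrix (Fin d) (Fin d) ℝ)) ν)
    (κ : Kernel (Fin B → EuclideanSpace ℝ (Fin d)) (EuclideanSpace ℝ (Fin d)))
    [IsMarkovKernel κ]
    (hκ : ∀ g : Fin B → EuclideanSpace ℝ (Fin d),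
      IsGaussian 0 (((⨆ i, ‖g i‖ ^ 2) * σ ^ 2) • (1 : Matrix (Fin d) (Fin d) ℝ)) (κ g)) :
    ENNReal.ofReal (lam * d + lam * σ ^ 2 * d ^ 2) ≤
      ∫⁻ p, ENNReal.ofReal (‖(p.1 ⟨0, hB⟩ + p.2) - gradw‖ ^ 2)
        ∂((Measure.pi fun _ : Fin B => ν) ⊗ₘ κ) := by
  have hS : ∀ g : Fin B → EuclideanSpace ℝ (Fin d), ‖g ⟨0, hB⟩‖ ^ 2 ≤ ⨆ i, ‖g i‖ ^ 2 :=
    fun g => le_ciSup (f := fun i => ‖g i‖ ^ 2) (Set.finite_range _).bddAbove ⟨0, hB⟩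
  rw [Measure.lintegral_compProd (by fun_prop)]
  have hin : ∀ g : Fin B → EuclideanSpace ℝ (Fin d),
      ENNReal.ofReal (‖-gradw + g ⟨0, hB⟩‖ ^ 2)
        + ENNReal.ofReal (σ ^ 2 * d) * ENNReal.ofReal (‖0 + g ⟨0, hB⟩‖ ^ 2) ≤
      ∫⁻ x, ENNReal.ofReal (‖(g ⟨0, hB⟩ + x) - gradw‖ ^ 2) ∂(κ g) := by
    intro g
    have h0 : 0 ≤ (⨆ i, ‖g i‖ ^ 2) := (sq_nonneg _).trans (hS g)
    have := aux_norm 0 (-gradw + g ⟨0, hB⟩) _ (mul_nonneg h0 (sq_nonneg σ)) (κ g) (hκ g)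
    have e : ∀ x, g ⟨0, hB⟩ + x - gradw = -gradw + g ⟨0, hB⟩ + x := fun x => by abel
    simp_rw [e]
    rw [this, ← ENNReal.ofReal_mul (by positivity),
      ← ENNReal.ofReal_add (by positivity) (by positivity)]
    apply ENNReal.ofReal_le_ofReal
    rw [add_zero, zero_add]
    have := mul_le_mul_of_nonneg_right (hS g) (show 0 ≤ σ ^ 2 * (d : ℝ) by positivity)
    linarith
  refine le_trans ?_ (lintegral_mono hin)
  have hev := measurePreserving_eval (fun _ : Fin B => ν) ⟨0, hB⟩
  have hc := hev.lintegral_comp (f := fun x => ENNReal.ofReal (‖-gradw + x‖ ^ 2)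
        + ENNReal.ofReal (σ ^ 2 * d) * ENNReal.ofReal (‖0 + x‖ ^ 2)) (by fun_prop)
  simp only [Function.eval] at hc
  rw [hc, lintegral_add_left (by fun_prop), lintegral_const_mul _ (by fun_prop),
    aux_norm _ _ lam hlam ν hν, aux_norm _ _ lam hlam ν hν, ← ENNReal.ofReal_mul (by positivity),
    ← ENNReal.ofReal_add (by positivity) (by positivity)]
  apply ENNReal.ofReal_le_ofReal
  have : 0 ≤ σ ^ 2 * (d : ℝ) * ‖0 + gradw‖ ^ 2 := by positivity
  simp only [neg_add_cancel, norm_zero]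
  nlinarith
end

section
/- Let ξ_1, …, ξ_B be random vectors in ℝ^d with E[max_{1≤i≤B} ‖ξ_i‖²] < ∞ and whose joint distribution is invariant under the global sign flip (ξ_1, …, ξ_B) ↦ (−ξ_1, …, −ξ_B), and let a ∈ ℝ^d. Then E[max_{1≤i≤B} ‖ξ_i + a‖²] ≥ E[max_{1≤i≤B} ‖ξ_i‖²] + ‖a‖². -/
open MeasureTheory ProbabilityTheory

/-- If `ξ_1, …, ξ_B` are random vectors in `ℝ^d` whose joint law is
invariant under the global sign flip `(ξ_1, …, ξ_B) ↦ (−ξ_1, …, −ξ_B)` and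
`E[max_i ‖ξ_i‖²] < ∞`, then for any `a ∈ ℝ^d`,
`E[max_i ‖ξ_i + a‖²] ≥ E[max_i ‖ξ_i‖²] + ‖a‖²`. -/
theorem expected_max_sq_norm_shift {d B : ℕ} (hB : 1 ≤ B)
    {Ω : Type*} [MeasurableSpace Ω] (P : Measure Ω) [IsProbabilityMeasure P]
    (X : Ω → Fin B → EuclideanSpace ℝ (Fin d)) (hX : Measurable X)
    (hsym : P.map (fun ω => fun i => -(X ω i)) = P.map X)
    (hint : Integrable (fun ω => ⨆ i, ‖X ω i‖ ^ 2) P)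
    (a : EuclideanSpace ℝ (Fin d)) :
    (∫ ω, (⨆ i, ‖X ω i‖ ^ 2) ∂P) + ‖a‖ ^ 2 ≤ ∫ ω, (⨆ i, ‖X ω i + a‖ ^ 2) ∂P := by
  haveI : Nonempty (Fin B) := ⟨⟨0, hB⟩⟩
  let F : (Fin B → EuclideanSpace ℝ (Fin d)) → ℝ := fun x => ⨆ i, ‖x i + a‖ ^ 2
  have hF : Measurable F := by
    refine Measurable.iSup (fun i => ?_)
    fun_prop
  have hneg : Measurable (fun ω => fun i => -(X ω i)) := by fun_prop
  have bdd : ∀ f : Fin B → ℝ, BddAbove (Set.range f) := fun f => (Set.finite_range f).bddAbove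
  have key : ∀ u : EuclideanSpace ℝ (Fin d),
      ‖u + a‖ ^ 2 + ‖-u + a‖ ^ 2 = 2 * (‖u‖ ^ 2 + ‖a‖ ^ 2) := by
    intro u
    have h := parallelogram_law_with_norm ℝ u a
    have h2 : ‖-u + a‖ = ‖u - a‖ := by rw [← norm_neg]; congr 1; abel
    rw [h2]; nlinarith [h]
  have hFnn : ∀ x, 0 ≤ F x := fun x => Real.iSup_nonneg (fun i => by positivity)
  have intF : ∀ Y : Ω → Fin B → EuclideanSpace ℝ (Fin d), Measurable Y →
      (∀ ω i, ‖Y ω i‖ = ‖X ω i‖) → Integrable (fun ω => F (Y ω)) P := by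
    intro Y hY hn
    refine Integrable.mono' ((hint.add (integrable_const (‖a‖ ^ 2))).const_mul 2)
      (hF.comp hY).aestronglyMeasurable (Filter.Eventually.of_forall fun ω => ?_)
    rw [Real.norm_of_nonneg (hFnn _)]
    refine ciSup_le fun i => ?_
    have h1 := le_ciSup (bdd fun i => ‖X ω i‖ ^ 2) i
    have h2 := key (Y ω i)
    rw [hn] at h2
    have h3 := sq_nonneg ‖-(Y ω i) + a‖
    simp only [Pi.add_apply] at h1 ⊢
    linarith
  have i1 := intF X hX (fun _ _ => rfl)
  have i2 := intF (fun ω i => -(X ω i)) hneg (fun _ _ => norm_neg _)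
  have heq : ∫ ω, F (fun i => -(X ω i)) ∂P = ∫ ω, F (X ω) ∂P := by
    rw [← integral_map hneg.aemeasurable hF.aestronglyMeasurable, hsym,
      integral_map hX.aemeasurable hF.aestronglyMeasurable]
  have hle : ∫ ω, 2 * ((⨆ i, ‖X ω i‖ ^ 2) + ‖a‖ ^ 2) ∂P
      ≤ ∫ ω, (F (X ω) + F (fun i => -(X ω i))) ∂P := by
    refine integral_mono ((hint.add (integrable_const (‖a‖ ^ 2))).const_mul 2)
      (i1.add i2) (fun ω => ?_)
    obtain ⟨i, hi⟩ := exists_eq_ciSup_of_finite (f := fun i => ‖X ω i‖ ^ 2)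
    have h1 := le_ciSup (bdd fun i => ‖X ω i + a‖ ^ 2) i
    have h2 := le_ciSup (bdd fun i => ‖-(X ω i) + a‖ ^ 2) i
    have h3 := key (X ω i)
    simp only [F] at hi h1 h2 ⊢
    rw [← hi]
    linarith
  rw [integral_add i1 i2, heq, integral_const_mul,
    integral_add hint (integrable_const _)] at hle
  simp only [integral_const, probReal_univ, one_smul, F] at hle
  linarith
end

section
/- Let d ∈ ℕ, k ≤ d, and let m be a random freeze mask with k active coordinates, with freeze rate r = 1 − k/d. Then for any fixed vector v ∈ ℝ^d and any threshold τ > 0, E[ min(‖m ⊙ v‖, τ)·‖m ⊙ v‖ ] ≥ (1 − r)·min(‖v‖, τ)·‖v‖. -/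
open MeasureTheory ProbabilityTheory
open scoped RealInnerProductSpace

/-- Build a vector of `EuclideanSpace ℝ (Fin d)` from its coordinates. -/
noncomputable def toE {d : ℕ} (f : Fin d → ℝ) : EuclideanSpace ℝ (Fin d) :=
  (WithLp.equiv 2 (Fin d → ℝ)).symm f

/-- The set of freeze masks on `{0,1}^d` with exactly `k` active coordinates,
represented by the subset of active coordinates. A *random freeze mask with `k` active
coordinates* is uniformly distributed on this finite set, so its expectations are
finite averages over `masks d k`. -/
def masks (d k : ℕ) : Finset (Finset (Fin d)) := Finset.powersetCard k Finset.univ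

/-- The `{0,1}`-valued mask vector associated to a set `s` of active coordinates. -/
def maskFun {d : ℕ} (s : Finset (Fin d)) : Fin d → ℝ := fun i => if i ∈ s then 1 else 0

/-- Coordinatewise (Hadamard) product `m ⊙ u` of the mask of `s` with a vector `u ∈ ℝ^d`. -/
noncomputable def maskMul {d : ℕ} (s : Finset (Fin d)) (u : EuclideanSpace ℝ (Fin d)) :
    EuclideanSpace ℝ (Fin d) := toE fun i => maskFun s i * u i

lemma aux_count {d k : ℕ} (hk : k ≤ d) (i : Fin d) :
    (d : ℝ) * (((masks d k).filter (fun s => i ∈ s)).card : ℝ) = k * ((masks d k).card : ℝ) := by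
  obtain _ | n := d
  · exact i.elim0
  have h1 : (masks (n+1) k).filter (fun s => ¬ i ∈ s)
      = Finset.powersetCard k (Finset.univ.erase i) := by
    ext s
    simp only [masks, Finset.mem_filter, Finset.mem_powersetCard, Finset.subset_erase]
    tauto
  have h2 := Finset.card_filter_add_card_filter_not (s := masks (n+1) k) (fun s => i ∈ s)
  rw [h1, Finset.card_powersetCard, Finset.card_erase_of_mem (Finset.mem_univ i),
    Finset.card_univ, Fintype.card_fin, Nat.add_sub_cancel] at h2
  have h3 := Nat.choose_mul_succ_eq n k
  have h4 : (masks (n+1) k).card = (n+1).choose k := by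
    simp [masks]
  rw [← h4] at h3
  have h2' : ((((masks (n+1) k).filter (fun s => i ∈ s)).card : ℝ)) + (n.choose k : ℝ)
    = ((masks (n+1) k).card : ℝ) := by exact_mod_cast h2
  have h3' : (n.choose k : ℝ) * (n + 1) = ((masks (n+1) k).card : ℝ) * (n + 1 - k) := by
    have := congrArg (Nat.cast : ℕ → ℝ) h3
    rw [Nat.cast_mul, Nat.cast_mul, Nat.cast_sub hk] at this
    push_cast at this
    exact this
  push_cast
  linear_combination (n + 1 : ℝ) * h2' - h3'

lemma aux_norm_s9 {d : ℕ} (s : Finset (Fin d)) (v : EuclideanSpace ℝ (Fin d)) :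
    ‖maskMul s v‖ ^ 2 = ∑ i, if i ∈ s then v i ^ 2 else 0 := by
  rw [EuclideanSpace.real_norm_sq_eq]
  refine Finset.sum_congr rfl fun i _ => ?_
  by_cases h : i ∈ s <;> simp [maskMul, toE, maskFun, h]

lemma aux_sum {d k : ℕ} (hk : k ≤ d) (v : EuclideanSpace ℝ (Fin d)) :
    (d : ℝ) * ∑ s ∈ masks d k, ‖maskMul s v‖ ^ 2 = k * ((masks d k).card : ℝ) * ‖v‖ ^ 2 := by
  simp_rw [aux_norm_s9]
  rw [Finset.sum_comm, EuclideanSpace.real_norm_sq_eq, Finset.mul_sum, Finset.mul_sum]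
  refine Finset.sum_congr rfl fun i _ => ?_
  rw [← Finset.sum_filter, Finset.sum_const, nsmul_eq_mul, ← mul_assoc, aux_count hk]

/-- case-analysis step in the proof of the paper's Theorem 2. For a
uniformly random freeze mask `m` with `k` active coordinates (freeze rate `r = 1 − k/d`),
any `v ∈ ℝ^d` and any threshold `τ > 0`,
`E[min(‖m ⊙ v‖, τ)·‖m ⊙ v‖] ≥ (1 − r)·min(‖v‖, τ)·‖v‖`. -/
theorem expected_mask_clipped_norm_ge {d k : ℕ} (hk : k ≤ d) (r : ℝ)
    (hr : r = 1 - (k : ℝ) / d) (v : EuclideanSpace ℝ (Fin d)) (τ : ℝ) (hτ : 0 < τ) :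
    (1 - r) * (min ‖v‖ τ * ‖v‖) ≤
      ((masks d k).card : ℝ)⁻¹ * ∑ s ∈ masks d k, min ‖maskMul s v‖ τ * ‖maskMul s v‖ := by
  subst hr
  have hcard : 0 < ((masks d k).card : ℝ) := by
    have : (masks d k).card = d.choose k := by simp [masks]
    rw [this]
    exact_mod_cast Nat.choose_pos hk
  have hnn : 0 ≤ ∑ s ∈ masks d k, min ‖maskMul s v‖ τ * ‖maskMul s v‖ :=
    Finset.sum_nonneg fun s _ => by positivity
  rcases Nat.eq_zero_or_pos d with hd | hd
  · subst hd
    simp only [Nat.cast_zero, div_zero, sub_zero, sub_self, zero_mul]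
    exact mul_nonneg (inv_nonneg.mpr hcard.le) hnn
  have hd' : (0 : ℝ) < d := by exact_mod_cast hd
  rcases (norm_nonneg v).eq_or_lt with hv | hv
  · rw [← hv, mul_zero, mul_zero]
    exact mul_nonneg (inv_nonneg.mpr hcard.le) hnn
  have key : ∀ s ∈ masks d k, min ‖v‖ τ * ‖maskMul s v‖ ^ 2 ≤
      ‖v‖ * (min ‖maskMul s v‖ τ * ‖maskMul s v‖) := by
    intro s _
    have hle : ‖maskMul s v‖ ≤ ‖v‖ := by
      refine le_of_sq_le_sq ?_ (norm_nonneg v)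
      rw [aux_norm_s9, EuclideanSpace.real_norm_sq_eq]
      refine Finset.sum_le_sum fun i _ => ?_
      split_ifs
      · exact le_rfl
      · positivity
    have h0 := norm_nonneg (maskMul s v)
    have : min ‖v‖ τ * ‖maskMul s v‖ ≤ ‖v‖ * min ‖maskMul s v‖ τ := by
      rcases min_cases ‖maskMul s v‖ τ with ⟨h, _⟩ | ⟨h, _⟩ <;> rw [h]
      · exact mul_le_mul_of_nonneg_right (min_le_left _ _) h0
      · rw [mul_comm]
        exact mul_le_mul hle (min_le_right _ _) (by positivity) (norm_nonneg v)
    nlinarith [mul_le_mul_of_nonneg_right this h0]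
  have hs := Finset.sum_le_sum key
  rw [← Finset.mul_sum, ← Finset.mul_sum] at hs
  have ha := aux_sum hk v
  have hA : ∑ s ∈ masks d k, ‖maskMul s v‖ ^ 2
      = k / d * ((masks d k).card : ℝ) * ‖v‖ ^ 2 := by
    field_simp
    linarith
  rw [hA] at hs
  rw [sub_sub_cancel, inv_mul_eq_div, le_div_iff₀ hcard]
  refine le_of_mul_le_mul_left ?_ hv
  linarith
end
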